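/- Let J be a Z₂-graded vector space with an even bilinear product ∘ and an even linear map α multiplicative with respect to ∘. Then (J, ∘, α) is a Hom-pre-Jordan superalgebra if and only if (J, ·, α) is a Hom-Jordan superalgebra, where x · y = x ∘ y + (-1)^{|x||y|} y ∘ x, and (J, L, α) is a representation of (J, ·, α), where L is the left multiplication operator L_x(y) = x ∘ y. -/

import Mathlib

open scoped TensorProduct

noncomputable section

/-- The sign `(-1)^e` attached to a parity `e : ZMod 2`. -/
def gsign (K : Type*) [Field K] (e : ZMod 2) : K := (-1 : K) ^ e.val

variable {K : Type*} [Field K] [CharZero K]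
variable {J V : Type*} [AddCommGroup J] [Module K J] [AddCommGroup V] [Module K V]

/-- An even bilinear map with respect to a `ZMod 2`-grading. -/
def EvenBilin (g : ZMod 2 → Submodule K J) (m : J →ₗ[K] J →ₗ[K] J) : Prop :=
  ∀ i j : ZMod 2, ∀ x ∈ g i, ∀ y ∈ g j, m x y ∈ g (i + j)

/-- An even linear map with respect to a `ZMod 2`-grading. -/
def EvenMap (g : ZMod 2 → Submodule K J) (α : J →ₗ[K] J) : Prop :=
  ∀ i : ZMod 2, ∀ x ∈ g i, α x ∈ g i

/-- Super-commutativity `x·y = (-1)^{|x||y|} y·x` on homogeneous elements. -/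
def SuperComm (g : ZMod 2 → Submodule K J) (m : J →ₗ[K] J →ₗ[K] J) : Prop :=
  ∀ i j : ZMod 2, ∀ x ∈ g i, ∀ y ∈ g j, m x y = gsign K (i * j) • m y x

/-- The Hom-associator `as_α(x,y,z) = (x·y)·α(z) − α(x)·(y·z)`. -/
def hAss (m : J →ₗ[K] J →ₗ[K] J) (α : J →ₗ[K] J) (x y z : J) : J :=
  m (m x y) (α z) - m (α x) (m y z)

/-- The Hom-Jordan super-identity: the cyclic sum over `(x,y,u)` of
`(-1)^{|u|(|x|+|z|)} as_α(x·y, α(z), α(u))` vanishes. -/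
def HomJordanId (g : ZMod 2 → Submodule K J) (m : J →ₗ[K] J →ₗ[K] J) (α : J →ₗ[K] J) : Prop :=
  ∀ px py pz pu : ZMod 2, ∀ x ∈ g px, ∀ y ∈ g py, ∀ z ∈ g pz, ∀ u ∈ g pu,
      gsign K (pu * (px + pz)) • hAss m α (m x y) (α z) (α u)
    + gsign K (px * (py + pz)) • hAss m α (m y u) (α z) (α x)
    + gsign K (py * (pu + pz)) • hAss m α (m u x) (α z) (α y) = 0

/-- Hom-Jordan superalgebra. -/
def IsHomJordan (g : ZMod 2 → Submodule K J) (m : J →ₗ[K] J →ₗ[K] J) (α : J →ₗ[K] J) : Prop :=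
  EvenBilin g m ∧ EvenMap g α ∧ SuperComm g m ∧ HomJordanId g m α

/-- `α` is multiplicative with respect to `m`. -/
def IsMult (m : J →ₗ[K] J →ₗ[K] J) (α : J →ₗ[K] J) : Prop :=
  ∀ x y : J, α (m x y) = m (α x) (α y)

/-- Multiplicative Hom-Jordan superalgebra. -/
def IsMultHomJordan (g : ZMod 2 → Submodule K J) (m : J →ₗ[K] J →ₗ[K] J) (α : J →ₗ[K] J) :
    Prop :=
  IsHomJordan g m α ∧ IsMult m α

/-- Evenness of a representation map. -/
def EvenRepMap (g : ZMod 2 → Submodule K J) (gV : ZMod 2 → Submodule K V)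
    (π : J →ₗ[K] Module.End K V) : Prop :=
  ∀ i j : ZMod 2, ∀ x ∈ g i, ∀ v ∈ gV j, π x v ∈ gV (i + j)

/-- Representation (module) of a Hom-Jordan superalgebra. -/
def IsRep (g : ZMod 2 → Submodule K J) (m : J →ₗ[K] J →ₗ[K] J) (α : J →ₗ[K] J)
    (gV : ZMod 2 → Submodule K V) (π : J →ₗ[K] Module.End K V) (β : Module.End K V) : Prop :=
  EvenRepMap g gV π ∧ (∀ i : ZMod 2, ∀ v ∈ gV i, β v ∈ gV i) ∧
  (∀ x : J, β * π x = π (α x) * β) ∧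
  (∀ px py pz : ZMod 2, ∀ x ∈ g px, ∀ y ∈ g py, ∀ z ∈ g pz,
      gsign K (px * pz) • (π (m (α x) (α y)) * π (α z) * β)
    + gsign K (px * py) • (π (m (α y) (α z)) * π (α x) * β)
    + gsign K (py * pz) • (π (m (α z) (α x)) * π (α y) * β)
    = gsign K (px * pz) • (π (α (α x)) * π (m y z) * β)
    + gsign K (px * py) • (π (α (α y)) * π (m z x) * β)
    + gsign K (py * pz) • (π (α (α z)) * π (m x y) * β)) ∧
  (∀ px py pz : ZMod 2, ∀ x ∈ g px, ∀ y ∈ g py, ∀ z ∈ g pz,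
      gsign K (px * pz) • (π (m (α x) (α y)) * π (α z) * β)
    + gsign K (px * py) • (π (m (α y) (α z)) * π (α x) * β)
    + gsign K (py * pz) • (π (m (α z) (α x)) * π (α y) * β)
    = gsign K (px * pz) • (π (α (α x)) * π (α y) * π z)
    + gsign K (px * py + py * pz) • (π (α (α z)) * π (α y) * π x)
    + gsign K (py * pz + px * pz) • (π (m (m x z) (α y)) * (β * β)))

/-- O-operator on `J` associated to the representation `(V, π, β)`. -/
def IsOOperator (g : ZMod 2 → Submodule K J) (m : J →ₗ[K] J →ₗ[K] J) (α : J →ₗ[K] J)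
    (gV : ZMod 2 → Submodule K V) (π : J →ₗ[K] Module.End K V) (β : Module.End K V)
    (T : V →ₗ[K] J) : Prop :=
  (∀ i : ZMod 2, ∀ v ∈ gV i, T v ∈ g i) ∧
  (∀ v : V, α (T v) = T (β v)) ∧
  (∀ i j : ZMod 2, ∀ u ∈ gV i, ∀ v ∈ gV j,
    m (T u) (T v) = T (π (T u) v + gsign K (i * j) • π (T v) u))

/-- The grading on a direct sum `J ⊕ V`. -/
def prodGrading (g : ZMod 2 → Submodule K J) (gV : ZMod 2 → Submodule K V) :
    ZMod 2 → Submodule K (J × V) := fun i => (g i).prod (gV i)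

/-- The semidirect product multiplication, determined on homogeneous elements. -/
def IsSemidirectMul (g : ZMod 2 → Submodule K J) (gV : ZMod 2 → Submodule K V)
    (m : J →ₗ[K] J →ₗ[K] J) (π : J →ₗ[K] Module.End K V)
    (m' : (J × V) →ₗ[K] (J × V) →ₗ[K] (J × V)) : Prop :=
  ∀ i j : ZMod 2, ∀ x ∈ g i, ∀ u ∈ gV i, ∀ y ∈ g j, ∀ v ∈ gV j,
    m' (x, u) (y, v) = (m x y, π x v + gsign K (i * j) • π y u)

/-- The induced grading on the linear dual. -/
def dualGrading (gV : ZMod 2 → Submodule K V) (i : ZMod 2) :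
    Submodule K (Module.Dual K V) where
  carrier := {ξ | ∀ x ∈ gV (i + 1), ξ x = 0}
  add_mem' := by
    intro a b ha hb x hx
    simp [ha x hx, hb x hx]
  zero_mem' := by
    intro x hx
    simp
  smul_mem' := by
    intro c a ha x hx
    simp [ha x hx]

/-- Nijenhuis operator on a Hom-Jordan superalgebra. -/
def IsNijenhuis (gA : ZMod 2 → Submodule K J) (mA : J →ₗ[K] J →ₗ[K] J)
    (γ N : J →ₗ[K] J) : Prop :=
  EvenMap gA N ∧ N ∘ₗ γ = γ ∘ₗ N ∧
  ∀ x y : J, mA (N x) (N y) = N (mA (N x) y + mA x (N y) - N (mA x y))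

/-- The super-symmetrized product `x·y = x∘y + (-1)^{|x||y|} y∘x` on homogeneous
elements of parities `i`, `j`. -/
def sMul (c : J →ₗ[K] J →ₗ[K] J) (i j : ZMod 2) (x y : J) : J :=
  c x y + gsign K (i * j) • c y x

/-- Hom-pre-Jordan superalgebra. -/
def IsHomPreJordan (g : ZMod 2 → Submodule K J) (c : J →ₗ[K] J →ₗ[K] J) (α : J →ₗ[K] J) :
    Prop :=
  EvenBilin g c ∧ EvenMap g α ∧ IsMult c α ∧
  (∀ px py pz pu : ZMod 2, ∀ x ∈ g px, ∀ y ∈ g py, ∀ z ∈ g pz, ∀ u ∈ g pu,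
      c (sMul c px py (α x) (α y)) (c (α z) (α u))
    + gsign K (px * (py + pz)) • c (sMul c py pz (α y) (α z)) (c (α x) (α u))
    + gsign K (pz * (px + py)) • c (sMul c pz px (α z) (α x)) (c (α y) (α u))
    = c (α (α x)) (c (sMul c py pz y z) (α u))
    + gsign K (px * (py + pz)) • c (α (α y)) (c (sMul c pz px z x) (α u))
    + gsign K (pz * (px + py)) • c (α (α z)) (c (sMul c px py x y) (α u))) ∧
  (∀ px py pz pu : ZMod 2, ∀ x ∈ g px, ∀ y ∈ g py, ∀ z ∈ g pz, ∀ u ∈ g pu,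
      c (α (α x)) (c (α y) (c z u))
    + gsign K (pz * (px + py) + px * py) • c (α (α z)) (c (α y) (c x u))
    + gsign K (py * pz) • c (sMul c (px + pz) py (sMul c px pz x z) (α y)) (α (α u))
    = c (α (α x)) (c (sMul c py pz y z) (α u))
    + gsign K (px * (py + pz)) • c (α (α y)) (c (sMul c pz px z x) (α u))
    + gsign K (pz * (px + py)) • c (α (α z)) (c (sMul c px py x y) (α u)))

/-- Hom-dendriform superalgebra, with `p = ≺` and `s = ≻`. -/
def IsHomDendriform (g : ZMod 2 → Submodule K J)
    (p s : J →ₗ[K] J →ₗ[K] J) (α : J →ₗ[K] J) : Prop :=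
  EvenBilin g p ∧ EvenBilin g s ∧ EvenMap g α ∧ IsMult p α ∧ IsMult s α ∧
  (∀ x y z : J, s (α x) (s y z) = s (p x y + s x y) (α z)) ∧
  (∀ x y z : J, p (p x y) (α z) = p (α x) (p y z + s y z)) ∧
  (∀ x y z : J, p (s x y) (α z) = s (α x) (p y z))

/-- Hom-alternative superalgebra. -/
def IsHomAlternative (g : ZMod 2 → Submodule K J) (m : J →ₗ[K] J →ₗ[K] J)
    (α : J →ₗ[K] J) : Prop :=
  EvenBilin g m ∧ EvenMap g α ∧
  (∀ i j : ZMod 2, ∀ x ∈ g i, ∀ y ∈ g j, ∀ z : J,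
    hAss m α x y z = -(gsign K (i * j) • hAss m α y x z)) ∧
  (∀ j k : ZMod 2, ∀ y ∈ g j, ∀ z ∈ g k, ∀ x : J,
    hAss m α x y z = -(gsign K (j * k) • hAss m α x z y))

/-- `ass_l` for a Hom-pre-alternative superalgebra, `p = ≺`, `s = ≻`. -/
def passL (p s : J →ₗ[K] J →ₗ[K] J) (α : J →ₗ[K] J) (x y z : J) : J :=
  s (p x y + s x y) (α z) - s (α x) (s y z)

/-- `ass_m` for a Hom-pre-alternative superalgebra. -/
def passM (p s : J →ₗ[K] J →ₗ[K] J) (α : J →ₗ[K] J) (x y z : J) : J :=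
  p (s x y) (α z) - s (α x) (p y z)

/-- `ass_r` for a Hom-pre-alternative superalgebra. -/
def passR (p s : J →ₗ[K] J →ₗ[K] J) (α : J →ₗ[K] J) (x y z : J) : J :=
  p (p x y) (α z) - p (α x) (p y z + s y z)

/-- Hom-pre-alternative superalgebra. -/
def IsHomPreAlternative (g : ZMod 2 → Submodule K J)
    (p s : J →ₗ[K] J →ₗ[K] J) (α : J →ₗ[K] J) : Prop :=
  EvenBilin g p ∧ EvenBilin g s ∧ EvenMap g α ∧
  (∀ i j : ZMod 2, ∀ x ∈ g i, ∀ y ∈ g j, ∀ z : J,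
    passM p s α x y z + gsign K (i * j) • passR p s α y x z = 0) ∧
  (∀ j k : ZMod 2, ∀ y ∈ g j, ∀ z ∈ g k, ∀ x : J,
    passM p s α x y z + gsign K (j * k) • passL p s α x z y = 0) ∧
  (∀ i j : ZMod 2, ∀ x ∈ g i, ∀ y ∈ g j, ∀ z : J,
    passL p s α x y z + gsign K (i * j) • passL p s α y x z = 0) ∧
  (∀ j k : ZMod 2, ∀ y ∈ g j, ∀ z ∈ g k, ∀ x : J,
    passR p s α x y z + gsign K (j * k) • passR p s α x z y = 0)

/-- `r = Σ Xₗ ⊗ Yₗ` (with `Xₗ, Yₗ` homogeneous of parities `Pₗ, Qₗ`) is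
super skew-symmetric: `σ(r) = -r`. -/
def SkewSol {ι : Type*} [Fintype ι] {A : Type*} [AddCommGroup A] [Module K A]
    (X Y : ι → A) (P Q : ι → ZMod 2) : Prop :=
  (∑ l, gsign K (P l * Q l) • (Y l ⊗ₜ[K] X l)) = -(∑ l, X l ⊗ₜ[K] Y l)

/-- `r = Σ Xₗ ⊗ Yₗ` solves the super Hom-Jordan Yang-Baxter equation
`r₁₂·r₁₃ − r₁₂·r₂₃ + r₁₃·r₂₃ = 0`. -/
def YBESol {ι : Type*} [Fintype ι] {A : Type*} [AddCommGroup A] [Module K A]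
    (mA : A →ₗ[K] A →ₗ[K] A) (γ : A →ₗ[K] A) (X Y : ι → A) (P Q : ι → ZMod 2) : Prop :=
  (∑ l, ∑ l', gsign K (P l' * Q l) • ((mA (X l) (X l') ⊗ₜ[K] γ (Y l)) ⊗ₜ[K] γ (Y l')))
    - (∑ l, ∑ l', (γ (X l) ⊗ₜ[K] mA (Y l) (X l')) ⊗ₜ[K] γ (Y l'))
    + (∑ l, ∑ l', gsign K (P l' * Q l) • ((γ (X l) ⊗ₜ[K] γ (X l')) ⊗ₜ[K] mA (Y l) (Y l')))
    = 0

/-- The left components of the family representing `r = T − σ(T)` in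
`(J ⋉ V*) ⊗ (J ⋉ V*)`, for `T` regarded in `J ⊗ V*` via a homogeneous basis. -/
def rX {n : ℕ} (T : V →ₗ[K] J) (b : Module.Basis (Fin n) K V) (pe : Fin n → ZMod 2) :
    Fin n ⊕ Fin n → J × Module.Dual K V :=
  Sum.elim (fun k => (T (b k), 0))
    (fun k => -(gsign K (pe k * pe k)) • ((0 : J), b.coord k))

/-- The right components of the family representing `r = T − σ(T)`. -/
def rY {n : ℕ} (T : V →ₗ[K] J) (b : Module.Basis (Fin n) K V) :
    Fin n ⊕ Fin n → J × Module.Dual K V :=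
  Sum.elim (fun k => ((0 : J), b.coord k)) (fun k => (T (b k), 0))

/-- The parities of the family representing `r = T − σ(T)`. -/
def rP {n : ℕ} (pe : Fin n → ZMod 2) : Fin n ⊕ Fin n → ZMod 2 := Sum.elim pe pe
lemma gsign_zero' : gsign K 0 = 1 := by simp [gsign]

lemma gsign_one' : gsign K 1 = -1 := by
  have : (1 : ZMod 2).val = 1 := rfl
  simp [gsign, this]

lemma z2_cases (e : ZMod 2) : e = 0 ∨ e = 1 := by
  revert e; decide

lemma z2_two : (1 : ZMod 2) + 1 = 0 := rfl

lemma homog_ext (g : ZMod 2 → Submodule K J) (hg : DirectSum.IsInternal g)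
    {f h : J →ₗ[K] V} (H : ∀ i, ∀ u ∈ g i, f u = h u) : f = h := by
  ext u
  have hu : u ∈ iSup g := by rw [hg.submodule_iSup_eq_top]; trivial
  induction hu using Submodule.iSup_induction' with
  | mem i x hx => exact H i x hx
  | zero => simp
  | add x y _ _ hx hy => simp [hx, hy]

set_option maxHeartbeats 8000000 in
/-- `(J, ∘, α)` is a Hom-pre-Jordan superalgebra iff `(J, ·, α)` with
`x · y = x ∘ y + (-1)^{|x||y|} y ∘ x` is a Hom-Jordan superalgebra and the left
multiplication `L_x(y) = x ∘ y` makes `(J, L, α)` a representation of `(J, ·, α)`. -/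
theorem homPreJordan_iff_homJordan_and_rep (g : ZMod 2 → Submodule K J)
    (hg : DirectSum.IsInternal g)
    (c : J →ₗ[K] J →ₗ[K] J) (α : J →ₗ[K] J)
    (hce : EvenBilin g c) (hαe : EvenMap g α) (hmult : IsMult c α)
    (m : J →ₗ[K] J →ₗ[K] J)
    (hm : ∀ i j : ZMod 2, ∀ x ∈ g i, ∀ y ∈ g j,
      m x y = c x y + gsign K (i * j) • c y x) :
    IsHomPreJordan g c α ↔
      (IsMultHomJordan g m α ∧ IsRep g m α g c α) := by
  have hmult' : ∀ x y, α (c x y) = c (α x) (α y) := hmult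
  have hme : EvenBilin g m := by
    intro i j x hx y hy
    rw [hm i j x hx y hy]
    refine Submodule.add_mem _ (hce i j x hx y hy) (Submodule.smul_mem _ _ ?_)
    rw [add_comm]; exact hce j i y hy x hx
  have hmm : IsMult m α := by
    have : m.compr₂ α = m.compl₁₂ α α := by
      refine homog_ext g hg fun i x hx => homog_ext g hg fun j y hy => ?_
      simp only [LinearMap.compr₂_apply, LinearMap.compl₁₂_apply]
      rw [hm i j x hx y hy, hm i j _ (hαe i x hx) _ (hαe j y hy), map_add, map_smul, hmult', hmult']
    intro x y
    exact LinearMap.congr_fun₂ this x y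
  have hsm : ∀ i j : ZMod 2, ∀ x ∈ g i, ∀ y ∈ g j, sMul c i j x y = m x y :=
    fun i j x hx y hy => (hm i j x hx y hy).symm
  constructor
  · rintro ⟨-, -, -, h1, h2⟩
    refine ⟨⟨⟨hme, hαe, ?_, ?_⟩, hmm⟩, hce, hαe, ?_, ?_, ?_⟩
    · intro i j x hx y hy
      rw [hm i j x hx y hy, hm j i y hy x hx]
      rcases z2_cases i with rfl | rfl <;> rcases z2_cases j with rfl | rfl <;>
        simp only [mul_zero, mul_one, zero_mul, gsign_zero', gsign_one'] <;> module
    · intro px py pz pu x hx y hy z hz u hu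
      have hax := hαe _ _ hx
      have hay := hαe _ _ hy
      have haz := hαe _ _ hz
      have hau := hαe _ _ hu
      have e1 := h1 px py pu pz x hx y hy u hu z hz
      have a1 := h1 px pz py pu x hx z hz y hy u hu
      have a2 := h2 px pz py pu x hx z hz y hy u hu
      have b1 := h1 py pz pu px y hy z hz u hu x hx
      have b2 := h2 py pz pu px y hy z hz u hu x hx
      have c1 := h1 pu pz px py u hu z hz x hx y hy
      have c2 := h2 pu pz px py u hu z hz x hx y hy
      have hmm' : ∀ x y, α (m x y) = m (α x) (α y) := hmm
      simp only [hAss, hmm']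
      rw [hm _ _ _ (hme _ _ _ (hme _ _ _ hx _ hy) _ haz) _ (hαe _ _ hau),
        hm _ _ _ (hme _ _ _ (hme _ _ _ hy _ hu) _ haz) _ (hαe _ _ hax),
        hm _ _ _ (hme _ _ _ (hme _ _ _ hu _ hx) _ haz) _ (hαe _ _ hay),
        hm _ _ _ (hme _ _ _ hax _ hay) _ (hme _ _ _ haz _ hau),
        hm _ _ _ (hme _ _ _ hay _ hau) _ (hme _ _ _ haz _ hax),
        hm _ _ _ (hme _ _ _ hau _ hax) _ (hme _ _ _ haz _ hay),
        hm _ _ _ (hme _ _ _ hx _ hy) _ haz,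
        hm _ _ _ (hme _ _ _ hy _ hu) _ haz,
        hm _ _ _ (hme _ _ _ hu _ hx) _ haz,
        hm _ _ _ hx _ hy, hm _ _ _ hy _ hu, hm _ _ _ hu _ hx,
        hm _ _ _ hax _ hay, hm _ _ _ hay _ hau, hm _ _ _ hau _ hax,
        hm _ _ _ haz _ hax, hm _ _ _ haz _ hay, hm _ _ _ haz _ hau]
      simp only [sMul] at e1 a1 a2 b1 b2 c1 c2
      replace e1 := congrArg (fun t => gsign K (px * pu) • t) e1
      replace a1 := congrArg (fun t => gsign K (px * pu + pz * py + pz * pu) • t) a1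
      replace a2 := congrArg (fun t => gsign K (px * pu + pz * py + pz * pu) • t) a2
      replace b1 := congrArg (fun t => gsign K (py * px + pz * pu + pz * px) • t) b1
      replace b2 := congrArg (fun t => gsign K (py * px + pz * pu + pz * px) • t) b2
      replace c1 := congrArg (fun t => gsign K (pu * py + pz * px + pz * py) • t) c1
      replace c2 := congrArg (fun t => gsign K (pu * py + pz * px + pz * py) • t) c2
      rcases z2_cases px with rfl | rfl <;> rcases z2_cases py with rfl | rfl <;>
      rcases z2_cases pz with rfl | rfl <;> rcases z2_cases pu with rfl | rfl <;>
      simp only [mul_zero, mul_one, zero_mul, add_zero, zero_add, z2_two, gsign_zero', gsign_one',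
        map_add, map_smul, LinearMap.add_apply, LinearMap.smul_apply, one_smul, neg_smul, map_neg,
        LinearMap.neg_apply] at e1 a1 a2 b1 b2 c1 c2 ⊢ <;>
      linear_combination (norm := abel) -e1 + (a2 - a1) + (b2 - b1) + (c2 - c1)
    · intro x
      ext y
      simp [hmult' x y]
    · intro px py pz x hx y hy z hz
      refine homog_ext g hg fun pu u hu => ?_
      have e := h1 px py pz pu x hx y hy z hz u hu
      have hax := hαe _ _ hx
      have hay := hαe _ _ hy
      have haz := hαe _ _ hz
      rw [hsm _ _ _ hax _ hay, hsm _ _ _ hay _ haz, hsm _ _ _ haz _ hax,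
        hsm _ _ _ hx _ hy, hsm _ _ _ hy _ hz, hsm _ _ _ hz _ hx] at e
      simp only [LinearMap.add_apply, LinearMap.smul_apply, Module.End.mul_apply]
      rcases z2_cases px with rfl | rfl <;> rcases z2_cases py with rfl | rfl <;>
      rcases z2_cases pz with rfl | rfl <;>
      simp only [mul_zero, mul_one, zero_mul, add_zero, zero_add, z2_two, gsign_zero',
        gsign_one'] at e ⊢ <;>
      first
      | linear_combination (norm := module) e
      | linear_combination (norm := module) -e
    · intro px py pz x hx y hy z hz
      refine homog_ext g hg fun pu u hu => ?_
      have e := (h1 px py pz pu x hx y hy z hz u hu).trans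
        (h2 px py pz pu x hx y hy z hz u hu).symm
      have hax := hαe _ _ hx
      have hay := hαe _ _ hy
      have haz := hαe _ _ hz
      rw [hsm _ _ _ hax _ hay, hsm _ _ _ hay _ haz, hsm _ _ _ haz _ hax,
        hsm _ _ _ hx _ hz, hsm _ _ _ (hme _ _ _ hx _ hz) _ hay] at e
      simp only [LinearMap.add_apply, LinearMap.smul_apply, Module.End.mul_apply]
      rcases z2_cases px with rfl | rfl <;> rcases z2_cases py with rfl | rfl <;>
      rcases z2_cases pz with rfl | rfl <;>
      simp only [mul_zero, mul_one, zero_mul, add_zero, zero_add, z2_two, gsign_zero',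
        gsign_one'] at e ⊢ <;>
      first
      | linear_combination (norm := module) e
      | linear_combination (norm := module) -e
  · rintro ⟨-, -, -, -, h1, h2⟩
    refine ⟨hce, hαe, hmult, ?_, ?_⟩
    · intro px py pz pu x hx y hy z hz u hu
      have e := LinearMap.congr_fun (h1 px py pz x hx y hy z hz) u
      have hax := hαe _ _ hx
      have hay := hαe _ _ hy
      have haz := hαe _ _ hz
      rw [hsm _ _ _ hax _ hay, hsm _ _ _ hay _ haz, hsm _ _ _ haz _ hax,
        hsm _ _ _ hx _ hy, hsm _ _ _ hy _ hz, hsm _ _ _ hz _ hx]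
      simp only [LinearMap.add_apply, LinearMap.smul_apply, Module.End.mul_apply] at e
      rcases z2_cases px with rfl | rfl <;> rcases z2_cases py with rfl | rfl <;>
      rcases z2_cases pz with rfl | rfl <;>
      simp only [mul_zero, mul_one, zero_mul, add_zero, zero_add, z2_two, gsign_zero',
        gsign_one'] at e ⊢ <;>
      first
      | linear_combination (norm := module) e
      | linear_combination (norm := module) -e
    · intro px py pz pu x hx y hy z hz u hu
      have e := LinearMap.congr_fun
        ((h2 px py pz x hx y hy z hz).symm.trans (h1 px py pz x hx y hy z hz)) u
      have hay := hαe _ _ hy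
      rw [hsm _ _ _ hx _ hz, hsm _ _ _ (hme _ _ _ hx _ hz) _ hay,
        hsm _ _ _ hx _ hy, hsm _ _ _ hy _ hz, hsm _ _ _ hz _ hx]
      simp only [LinearMap.add_apply, LinearMap.smul_apply, Module.End.mul_apply] at e
      rcases z2_cases px with rfl | rfl <;> rcases z2_cases py with rfl | rfl <;>
      rcases z2_cases pz with rfl | rfl <;>
      simp only [mul_zero, mul_one, zero_mul, add_zero, zero_add, z2_two, gsign_zero',
        gsign_one'] at e ⊢ <;>
      first
      | linear_combination (norm := module) e
      | linear_combination (norm := module) -e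
end
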